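/- Let n ≥ 3 and 0 < m ≤ M, and let V = (v_ij) be an n×n symmetric matrix with v_ii = Σ_{j≠i} v_ij for every i and m ≤ v_ij ≤ M for all i ≠ j. Then V is invertible and 1/(2M(n−1)) ≤ ‖V^{−1}‖_∞ ≤ (3n−4)/(2m(n−1)(n−2)), where ‖A‖_∞ = max_i Σ_j |A_ij| is the matrix norm induced by the ℓ_∞ vector norm. -/

import Mathlib

open Finset Matrix

noncomputable section

/-- Weighted monotonicity. -/
lemma dual_ineq (n : ℕ) (m : ℝ)
    (V : Matrix (Fin n) (Fin n) ℝ) (hsym : V.IsSymm)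
    (hbal : ∀ i, V i i = ∑ j ∈ univ.erase i, V i j)
    (hlb : ∀ i j, i ≠ j → m ≤ V i j) (x y : Fin n → ℝ)
    (hxy : ∀ i j, i ≠ j → 0 ≤ (x i + x j) * (y i + y j)) :
    m * ∑ i, y i * (((n : ℝ) - 2) * x i + ∑ j, x j) ≤ ∑ i, y i * (V *ᵥ x) i := by
  have e1 : ∀ i, (V *ᵥ x) i = ∑ j ∈ univ.erase i, V i j * (x i + x j) := by
    intro i
    simp only [Matrix.mulVec, dotProduct, mul_add, sum_add_distrib]
    rw [← Finset.sum_mul, ← hbal i, Finset.add_sum_erase _ (fun j => V i j * x j) (mem_univ i)]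
  have e2 : ∀ i, ((n : ℝ) - 2) * x i + ∑ j, x j = ∑ j ∈ univ.erase i, (x i + x j) := by
    intro i
    have h1 := Finset.add_sum_erase univ (fun j => x i + x j) (mem_univ i)
    simp only [sum_add_distrib, sum_const, card_univ, Fintype.card_fin, nsmul_eq_mul] at h1 ⊢
    linarith
  have e3 : ∑ i, y i * (V *ᵥ x) i - m * ∑ i, y i * (((n : ℝ) - 2) * x i + ∑ j, x j)
      = ∑ i, ∑ j, if i = j then 0 else (V i j - m) * (x i + x j) * y i := by
    rw [Finset.mul_sum, ← Finset.sum_sub_distrib]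
    refine Finset.sum_congr rfl fun i _ => ?_
    rw [e1, e2, ← Finset.add_sum_erase univ (fun j => if i = j then (0:ℝ) else _) (mem_univ i)]
    simp only [if_true, zero_add]
    rw [Finset.mul_sum, Finset.mul_sum, Finset.mul_sum, ← Finset.sum_sub_distrib]
    refine Finset.sum_congr rfl fun j hj => ?_
    rw [if_neg (Finset.ne_of_mem_erase hj).symm]
    ring
  have e4 : (∑ i, ∑ j, if i = j then 0 else (V i j - m) * (x i + x j) * y i)
      = ∑ i, ∑ j, if i = j then 0 else (V i j - m) * (x i + x j) * y j := by
    rw [Finset.sum_comm]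
    refine Finset.sum_congr rfl fun i _ => Finset.sum_congr rfl fun j _ => ?_
    by_cases h : i = j
    · simp [h]
    · rw [if_neg h, if_neg (Ne.symm h), hsym.apply i j]; ring
  have e5 : 0 ≤ (∑ i, ∑ j, if i = j then 0 else (V i j - m) * (x i + x j) * y i)
      + ∑ i, ∑ j, if i = j then 0 else (V i j - m) * (x i + x j) * y j := by
    rw [← Finset.sum_add_distrib]
    refine Finset.sum_nonneg fun i _ => ?_
    rw [← Finset.sum_add_distrib]
    refine Finset.sum_nonneg fun j _ => ?_
    by_cases h : i = j
    · simp [h]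
    · rw [if_neg h, if_neg h]
      have := mul_nonneg (sub_nonneg.2 (hlb i j h)) (hxy i j h)
      nlinarith
  linarith

lemma scalar_ineq (g0 γ t : ℝ) (h0 : 1/5 ≤ g0) (h1 : g0 ≤ 1/3) (hγ : g0 < γ) (hγ1 : γ ≤ 1)
    (ht : 1 - g0 - γ < t) :
    0 ≤ 2 * (γ - g0) * (t + 1) + (1 - γ) * (2 * (t - γ)) := by
  have a1 : 0 ≤ (t - (1 - g0 - γ)) * ((γ - g0) + (1 - γ)) :=
    mul_nonneg (by linarith) (by linarith)
  have a2 : 0 ≤ (γ - g0)^2 - (1 - 3*g0) * (γ - g0) + (1 - 3*g0) * (1 - g0) := by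
    have : 0 ≤ (1 - 3*g0) * (1 - γ) := mul_nonneg (by linarith) (by linarith)
    nlinarith [sq_nonneg (γ - g0)]
  nlinarith

set_option maxHeartbeats 1000000 in
lemma exists_dual (n : ℕ) (hn : 3 ≤ n) (x : Fin n → ℝ) (i0 : Fin n) (hi0 : x i0 = 1)
    (hx : ∀ i, |x i| ≤ 1) :
    ∃ y : Fin n → ℝ, (∀ i j, i ≠ j → 0 ≤ (x i + x j) * (y i + y j)) ∧ 0 < ∑ i, |y i| ∧
      2 * ((n:ℝ) - 1) * ((n:ℝ) - 2) / (3 * (n:ℝ) - 4) * ∑ i, |y i|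
        ≤ ∑ i, y i * (((n : ℝ) - 2) * x i + ∑ j, x j) := by
  have hN : (3:ℝ) ≤ n := by exact_mod_cast hn
  set N : ℝ := (n:ℝ) with hNdef
  have hxl : ∀ i, -1 ≤ x i := fun i => (abs_le.1 (hx i)).1
  have hxu : ∀ i, x i ≤ 1 := fun i => (abs_le.1 (hx i)).2
  have hd : 0 < 3 * N - 4 := by linarith
  have hN2 : 0 < N - 2 := by linarith
  obtain ⟨g0, hg0⟩ : ∃ g0, g0 = (N - 2) / (3 * N - 4) := ⟨_, rfl⟩
  have hg0' : g0 * (3 * N - 4) = N - 2 := by rw [hg0, div_mul_cancel₀ _ hd.ne']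
  have hg0l : 1/5 ≤ g0 := by rw [hg0, div_le_div_iff₀ (by norm_num) hd]; linarith
  have hg0u : g0 ≤ 1/3 := by rw [hg0, div_le_div_iff₀ hd (by norm_num)]; linarith
  have hc : 2 * (N - 1) * (N - 2) / (3 * N - 4) = (N - 2) * (1 - g0) := by
    rw [div_eq_iff hd.ne']; linear_combination (N - 2) * hg0'
  rw [hc]
  obtain ⟨γ, hγ⟩ : ∃ γ, γ = -(∑ j, x j) / (N - 2) := ⟨_, rfl⟩
  have hσ : ∑ j, x j = -γ * (N - 2) := by rw [hγ]; field_simp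
  rw [hσ]
  have hcard : ((univ.erase i0).card : ℝ) = N - 1 := by
    rw [Finset.card_erase_of_mem (mem_univ _), card_univ, Fintype.card_fin, Nat.cast_sub (by omega)]
    simp [hNdef]
  have hsx : ∑ i ∈ univ.erase i0, x i = -γ * (N - 2) - 1 := by
    have := Finset.add_sum_erase univ x (mem_univ i0)
    linarith
  have hsx1 : ∑ i ∈ univ.erase i0, (x i + 1) = (1 - γ) * (N - 2) := by
    rw [sum_add_distrib, hsx, sum_const, nsmul_eq_mul, hcard]; ring
  rcases le_or_gt γ g0 with hle | hgt
  · refine ⟨Pi.single i0 1, ?_, ?_, ?_⟩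
    · intro i j hij
      have a := hxl i
      have b := hxl j
      by_cases h1 : i = i0
      · subst h1
        rw [Pi.single_eq_same, Pi.single_eq_of_ne hij.symm]
        nlinarith
      · by_cases h2 : j = i0
        · subst h2
          rw [Pi.single_eq_same, Pi.single_eq_of_ne hij]
          nlinarith
        · rw [Pi.single_eq_of_ne h1, Pi.single_eq_of_ne h2]; simp
    · rw [Finset.sum_eq_single i0] <;> simp +contextual
    · rw [Finset.sum_eq_single i0, Finset.sum_eq_single i0]
      · simp only [Pi.single_eq_same, hi0, abs_one]
        nlinarith
      all_goals simp +contextual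
  have hγ1 : γ ≤ 1 := by
    have : 0 ≤ (1 - γ) * (N - 2) := by
      rw [← hsx1]
      exact Finset.sum_nonneg fun i _ => by linarith [hxl i]
    have := nonneg_of_mul_nonneg_left this hN2
    linarith
  obtain ⟨s, hs⟩ : ∃ s, s = max (1 - g0 - γ) 0 := ⟨_, rfl⟩
  have hs0 : 0 ≤ s := hs ▸ le_max_right _ _
  have hsτ : 1 - g0 - γ ≤ s := hs ▸ le_max_left _ _
  have hs1 : s < 1 := by rw [hs]; exact max_lt (by linarith) one_pos
  have hs' : s = 0 ∨ s = 1 - g0 - γ := by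
    rw [hs]; rcases max_choice (1 - g0 - γ) 0 with h | h
    · right; exact h
    · left; exact h
  obtain ⟨y, hy⟩ : ∃ y : Fin n → ℝ, y = fun i => if s < x i then 1 else if x i ≤ -s then -1 else 0 :=
    ⟨_, rfl⟩
  have hyi : ∀ i, (s < x i ∧ y i = 1) ∨ (x i ≤ -s ∧ y i = -1) ∨ (-s < x i ∧ x i ≤ s ∧ y i = 0) := by
    intro i
    rw [hy]
    by_cases h1 : s < x i
    · left; simp [h1]
    · by_cases h2 : x i ≤ -s
      · right; left; simp [h1, h2]
      · right; right; simp only [h1, h2, if_false, and_true]; constructor <;> linarith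
  have hy0 : y i0 = 1 := by rw [hy]; simp [hi0, hs1]
  refine ⟨y, ?_, ?_, ?_⟩
  · intro i j _
    rcases hyi i with ⟨a, b⟩ | ⟨a, b⟩ | ⟨a, a', b⟩ <;> rcases hyi j with ⟨c, d⟩ | ⟨c, d⟩ | ⟨c, c', d⟩ <;>
      rw [b, d]
    · exact mul_nonneg (by linarith) (by norm_num)
    · simp
    · exact mul_nonneg (by linarith) (by norm_num)
    · simp
    · exact mul_nonneg_of_nonpos_of_nonpos (by linarith) (by norm_num)
    · exact mul_nonneg_of_nonpos_of_nonpos (by linarith) (by norm_num)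
    · exact mul_nonneg (by linarith) (by norm_num)
    · exact mul_nonneg_of_nonpos_of_nonpos (by linarith) (by norm_num)
    · simp
  · have : |y i0| ≤ ∑ i, |y i| :=
      Finset.single_le_sum (f := fun i => |y i|) (fun i _ => abs_nonneg _) (mem_univ i0)
    rw [hy0, abs_one] at this
    linarith
  obtain ⟨f, hf⟩ : ∃ f : Fin n → ℝ, f = fun i => y i * (x i - γ) - (1 - g0) * |y i| := ⟨_, rfl⟩
  have hfi : ∀ i, f i = y i * (x i - γ) - (1 - g0) * |y i| := fun i => by rw [hf]
  have hpt : ∀ i, 0 ≤ 2 * (γ - g0) * (x i + 1) + (1 - γ) * (f i + x i + (1 - g0 - γ)) := by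
    intro i
    have hp : 0 ≤ 2 * (γ - g0) * (x i + 1) := mul_nonneg (by linarith) (by linarith [hxl i])
    rcases hyi i with ⟨a, b⟩ | ⟨a, b⟩ | ⟨a, a', b⟩
    · have := scalar_ineq g0 γ (x i) hg0l hg0u hgt hγ1 (by linarith)
      rw [hfi, b, abs_one]
      linarith
    · rw [hfi, b, abs_neg, abs_one]
      linarith
    · have : 0 ≤ f i + x i + (1 - g0 - γ) := by
        rw [hfi, b, abs_zero]
        rcases hs' with h | h <;> linarith
      have := mul_nonneg (sub_nonneg.2 hγ1) this
      linarith
  have H : 0 ≤ 2 * (γ - g0) * (N - 2) + ∑ i ∈ univ.erase i0, (f i + x i + (1 - g0 - γ)) := by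
    rcases hγ1.lt_or_eq with h | h
    · have h1 := Finset.sum_nonneg (s := univ.erase i0) (fun i _ => hpt i)
      rw [sum_add_distrib, ← Finset.mul_sum, ← Finset.mul_sum, hsx1] at h1
      refine nonneg_of_mul_nonneg_right (a := 1 - γ) ?_ (by linarith)
      linarith
    · have h0 : ∀ i ∈ univ.erase i0, x i + 1 = 0 := by
        rw [← Finset.sum_eq_zero_iff_of_nonneg (fun i _ => by linarith [hxl i]), hsx1, h]; ring
      have h2 : ∀ i ∈ univ.erase i0, 0 ≤ f i + x i + (1 - g0 - γ) := by
        intro i hi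
        have := h0 i hi
        rcases hyi i with ⟨a, b⟩ | ⟨a, b⟩ | ⟨a, a', b⟩
        · linarith
        · rw [hfi, b, abs_neg, abs_one]; linarith
        · linarith
      have := Finset.sum_nonneg h2
      have : 0 ≤ 2 * (γ - g0) * (N - 2) := mul_nonneg (by linarith) hN2.le
      linarith
  rw [sum_add_distrib, sum_add_distrib, hsx, sum_const, nsmul_eq_mul, hcard] at H
  have hfs : 0 ≤ ∑ i, f i := by
    rw [← Finset.add_sum_erase univ f (mem_univ i0), hfi i0, hy0, hi0, abs_one]
    linarith
  have hfin : ∑ i, y i * ((N - 2) * x i + -γ * (N - 2)) - (N - 2) * (1 - g0) * ∑ i, |y i|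
      = (N - 2) * ∑ i, f i := by
    rw [Finset.mul_sum, Finset.mul_sum, ← Finset.sum_sub_distrib]
    refine Finset.sum_congr rfl fun i _ => ?_
    rw [hfi]; ring
  have := mul_nonneg hN2.le hfs
  linarith

lemma key_unit (n : ℕ) (hn : 3 ≤ n) (m : ℝ) (hm : 0 < m)
    (V : Matrix (Fin n) (Fin n) ℝ) (hsym : V.IsSymm)
    (hbal : ∀ i, V i i = ∑ j ∈ univ.erase i, V i j)
    (hlb : ∀ i j, i ≠ j → m ≤ V i j) (x : Fin n → ℝ) (i0 : Fin n) (hi0 : x i0 = 1)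
    (hx : ∀ i, |x i| ≤ 1) (B : ℝ) (hB : ∀ i, |(V *ᵥ x) i| ≤ B) :
    m * (2 * ((n:ℝ) - 1) * ((n:ℝ) - 2) / (3 * (n:ℝ) - 4)) ≤ B := by
  obtain ⟨y, h1, h2, h3⟩ := exists_dual n hn x i0 hi0 hx
  have h4 := dual_ineq n m V hsym hbal hlb x y h1
  have h5 : ∑ i, y i * (V *ᵥ x) i ≤ B * ∑ i, |y i| := by
    rw [Finset.mul_sum]
    refine Finset.sum_le_sum fun i _ => ?_
    calc y i * (V *ᵥ x) i ≤ |y i * (V *ᵥ x) i| := le_abs_self _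
      _ = |(V *ᵥ x) i| * |y i| := by rw [abs_mul, mul_comm]
      _ ≤ B * |y i| := mul_le_mul_of_nonneg_right (hB i) (abs_nonneg _)
  have h6 := mul_le_mul_of_nonneg_left h3 hm.le
  refine le_of_mul_le_mul_right ?_ h2
  linarith

lemma key_bound (n : ℕ) (hn : 3 ≤ n) (m : ℝ) (hm : 0 < m)
    (V : Matrix (Fin n) (Fin n) ℝ) (hsym : V.IsSymm)
    (hbal : ∀ i, V i i = ∑ j ∈ univ.erase i, V i j)
    (hlb : ∀ i j, i ≠ j → m ≤ V i j) (x : Fin n → ℝ) 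
    (B : ℝ) (hB : ∀ i, |(V *ᵥ x) i| ≤ B) (i : Fin n) :
    |x i| * (m * (2 * ((n:ℝ) - 1) * ((n:ℝ) - 2) / (3 * (n:ℝ) - 4))) ≤ B := by
  have hN : (3:ℝ) ≤ n := by exact_mod_cast hn
  have hC : 0 ≤ m * (2 * ((n:ℝ) - 1) * ((n:ℝ) - 2) / (3 * (n:ℝ) - 4)) :=
    mul_nonneg hm.le (div_nonneg (mul_nonneg (by linarith) (by linarith)) (by linarith))
  obtain ⟨i0, -, hmax⟩ := Finset.exists_max_image univ (fun i => |x i|) ⟨i, mem_univ i⟩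
  refine le_trans (mul_le_mul_of_nonneg_right (hmax i (mem_univ i)) hC) ?_
  by_cases h0 : x i0 = 0
  · rw [h0, abs_zero, zero_mul]; exact (abs_nonneg _).trans (hB i)
  have hpos : 0 < |x i0| := abs_pos.2 h0
  have := key_unit n hn m hm V hsym hbal hlb ((x i0)⁻¹ • x) i0 (by simp [h0])
    (by
      intro j
      rw [Pi.smul_apply, smul_eq_mul, abs_mul, abs_inv, inv_mul_le_iff₀ hpos, mul_one]
      exact hmax j (mem_univ j))
    (|x i0|⁻¹ * B)
    (by
      intro j
      rw [Matrix.mulVec_smul, Pi.smul_apply, smul_eq_mul, abs_mul, abs_inv]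
      exact mul_le_mul_of_nonneg_left (hB j) (by positivity))
  rwa [le_inv_mul_iff₀ hpos] at this

/-- two-sided bound on the ℓ∞-operator norm of the inverse of a
diagonally balanced matrix `V ∈ L_n(m, M)`. -/
theorem diagonally_balanced_inverse_norm_bounds
    (n : ℕ) (hn : 3 ≤ n) (m M : ℝ) (hm : 0 < m) (hmM : m ≤ M)
    (V : Matrix (Fin n) (Fin n) ℝ) (hsym : V.IsSymm)
    (hbal : ∀ i, V i i = ∑ j ∈ univ.erase i, V i j)
    (hlb : ∀ i j, i ≠ j → m ≤ V i j) (hub : ∀ i j, i ≠ j → V i j ≤ M) :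
    IsUnit V.det ∧
      1 / (2 * M * ((n : ℝ) - 1)) ≤ (⨆ i, ∑ j, |V⁻¹ i j|) ∧
      (⨆ i, ∑ j, |V⁻¹ i j|) ≤
        (3 * (n : ℝ) - 4) / (2 * m * ((n : ℝ) - 1) * ((n : ℝ) - 2)) := by
  have hN : (3:ℝ) ≤ n := by exact_mod_cast hn
  have hN1 : 0 < (n:ℝ) - 1 := by linarith
  have hN2 : 0 < (n:ℝ) - 2 := by linarith
  have hN4 : 0 < 3 * (n:ℝ) - 4 := by linarith
  have hM : 0 < M := hm.trans_le hmM
  have hC : 0 < m * (2 * ((n:ℝ) - 1) * ((n:ℝ) - 2) / (3 * (n:ℝ) - 4)) := by positivity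
  have i0 : Fin n := ⟨0, by omega⟩
  have : Nonempty (Fin n) := ⟨i0⟩
  have hdet : IsUnit V.det := by
    rw [isUnit_iff_ne_zero]
    intro h
    obtain ⟨v, hv, hv0⟩ := Matrix.exists_mulVec_eq_zero_iff.2 h
    apply hv
    funext i
    have := key_bound n hn m hm V hsym hbal hlb v 0 (by simp [hv0]) i
    have h2 : |v i| ≤ 0 := nonpos_of_mul_nonpos_left this hC
    exact abs_nonpos_iff.1 h2
  refine ⟨hdet, ?_, ?_⟩
  · refine le_trans ?_ (le_ciSup (Set.finite_range _).bddAbove i0)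
    rw [div_le_iff₀ (by positivity)]
    have h1 : V⁻¹ *ᵥ (V *ᵥ (fun _ => 1)) = fun _ => 1 := by
      rw [Matrix.mulVec_mulVec, Matrix.nonsing_inv_mul _ hdet, Matrix.one_mulVec]
    have h2 := congrFun h1 i0
    have hb : ∀ j, |(V *ᵥ (fun _ => (1:ℝ))) j| ≤ 2 * M * ((n:ℝ) - 1) := by
      intro j
      have e : (V *ᵥ (fun _ => (1:ℝ))) j = 2 * V j j := by
        simp only [Matrix.mulVec, dotProduct, mul_one]
        rw [← Finset.add_sum_erase univ _ (mem_univ j), ← hbal j]; ring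
      have hc : ((univ.erase j).card : ℝ) = (n:ℝ) - 1 := by
        rw [Finset.card_erase_of_mem (mem_univ _), card_univ, Fintype.card_fin,
          Nat.cast_sub (by omega)]
        simp
      have u : V j j ≤ M * ((n:ℝ) - 1) := by
        rw [hbal j, ← hc, mul_comm, ← nsmul_eq_mul]
        exact Finset.sum_le_card_nsmul _ _ _ fun k hk => hub j k (Finset.ne_of_mem_erase hk).symm
      have l : 0 ≤ V j j := by
        rw [hbal j]
        exact Finset.sum_nonneg fun k hk => hm.le.trans (hlb j k (Finset.ne_of_mem_erase hk).symm)
      rw [e, abs_of_nonneg (by linarith)]; linarith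
    calc (1:ℝ) = ∑ j, V⁻¹ i0 j * (V *ᵥ (fun _ => (1:ℝ))) j := h2.symm
      _ ≤ ∑ j, |V⁻¹ i0 j| * (2 * M * ((n:ℝ) - 1)) := by
        refine Finset.sum_le_sum fun j _ => (le_abs_self _).trans ?_
        rw [abs_mul]
        exact mul_le_mul_of_nonneg_left (hb j) (abs_nonneg _)
      _ = _ := by rw [Finset.sum_mul]
  · refine ciSup_le fun i => ?_
    obtain ⟨b, hb⟩ : ∃ b : Fin n → ℝ, b = fun j => if 0 ≤ V⁻¹ i j then 1 else -1 := ⟨_, rfl⟩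
    have h1 : V *ᵥ (V⁻¹ *ᵥ b) = b := by
      rw [Matrix.mulVec_mulVec, Matrix.mul_nonsing_inv _ hdet, Matrix.one_mulVec]
    have h2 := key_bound n hn m hm V hsym hbal hlb (V⁻¹ *ᵥ b) 1
      (by intro j; rw [h1, hb]; dsimp only; split_ifs <;> simp) i
    have h3 : (V⁻¹ *ᵥ b) i = ∑ j, |V⁻¹ i j| := by
      simp only [Matrix.mulVec, dotProduct]
      refine Finset.sum_congr rfl fun j _ => ?_
      rw [hb]; dsimp only
      split_ifs with h
      · rw [abs_of_nonneg h, mul_one]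
      · rw [abs_of_neg (not_le.1 h)]; ring
    rw [h3, abs_of_nonneg (Finset.sum_nonneg fun j _ => abs_nonneg _), ← le_div_iff₀ hC] at h2
    refine h2.trans (le_of_eq ?_)
    field_simp

end
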